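/- arXiv:2005.03952 — 3 statements merged into one kernel-verified Lean document; each statement's English description precedes it below -/
import Mathlib

section
/- Let S ≥ 0 and 0 ≤ h ≤ S be real numbers, and let (a_m)_{m≥1} be a sequence of nonnegative real numbers satisfying a_1 ≤ S² and, for all m ≥ 2, a_m ≤ a_{m−1} + S² + 2·√(a_{m−1})·h. Then for all m ≥ 1, a_m ≤ m²·(h² + C_m), where C_m := (1/m)(S² − h²)·Σ_{j=1}^m (1/j). In particular, a_m/m² ≤ h² + ((1 + log m)/m)·S². -/
open Finset

/-- The real-sequence recursion at the core of the proof of Theorem 1 of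
"Optimal Thinning of MCMC Output": if `a 1 ≤ S ^ 2` and
`a m ≤ a (m-1) + S ^ 2 + 2 * √(a (m-1)) * h` for `m ≥ 2`, with `0 ≤ h ≤ S`, then
`a m ≤ m ^ 2 * (h ^ 2 + C m)` where `C m = (1/m) * (S^2 - h^2) * ∑_{j=1}^m 1/j`, and in
particular `a m / m ^ 2 ≤ h ^ 2 + ((1 + log m) / m) * S ^ 2`. -/
theorem greedy_recursion_bound
    (S h : ℝ) (hS : 0 ≤ S) (hh0 : 0 ≤ h) (hhS : h ≤ S)
    (a : ℕ → ℝ) (ha0 : ∀ m, 1 ≤ m → 0 ≤ a m)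
    (ha1 : a 1 ≤ S ^ 2)
    (harec : ∀ m, 2 ≤ m →
      a m ≤ a (m - 1) + S ^ 2 + 2 * Real.sqrt (a (m - 1)) * h) :
    ∀ m : ℕ, 1 ≤ m →
      a m ≤ (m : ℝ) ^ 2 *
          (h ^ 2 + (1 / (m : ℝ)) * (S ^ 2 - h ^ 2) * ∑ j ∈ Finset.Icc 1 m, (1 / (j : ℝ)))
      ∧ a m / (m : ℝ) ^ 2 ≤ h ^ 2 + ((1 + Real.log m) / (m : ℝ)) * S ^ 2 := by
  have key : ∀ n : ℕ, a (n + 1) ≤ ((n : ℝ) + 1) ^ 2 * h ^ 2 +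
      ((n : ℝ) + 1) * ((S ^ 2 - h ^ 2) * ∑ j ∈ Finset.Icc 1 (n + 1), (1 / (j : ℝ))) := by
    intro n
    induction n with
    | zero => simpa using ha1
    | succ k ih =>
      have hr := harec (k + 1 + 1) (by omega)
      rw [Nat.add_sub_cancel] at hr
      rw [Finset.sum_Icc_succ_top (by omega : 1 ≤ k + 1 + 1)]
      set H := ∑ j ∈ Finset.Icc 1 (k + 1), (1 / (j : ℝ)) with hH
      have hs := Real.sq_sqrt (ha0 (k + 1) (by omega))
      set s := Real.sqrt (a (k + 1)) with hsdef
      push_cast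
      have hn : (0 : ℝ) < (k : ℝ) + 1 := by positivity
      set n : ℝ := (k : ℝ) + 1 with hndef
      have h1 : 2 * s * h ≤ 2 * n * h ^ 2 + (S ^ 2 - h ^ 2) * H := by
        refine le_of_mul_le_mul_left ?_ hn
        nlinarith [sq_nonneg (s - n * h)]
      have h2 : (n + 1) * ((S ^ 2 - h ^ 2) * (H + 1 / (n + 1)))
          = (n + 1) * ((S ^ 2 - h ^ 2) * H) + (S ^ 2 - h ^ 2) := by
        field_simp
      rw [h2]
      nlinarith
  intro m hm
  obtain ⟨n, rfl⟩ : ∃ n, m = n + 1 := ⟨m - 1, by omega⟩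
  have hk := key n
  have hlog : ∑ j ∈ Finset.Icc 1 (n + 1), (1 / (j : ℝ)) ≤ 1 + Real.log ((n + 1 : ℕ) : ℝ) := by
    have := harmonic_le_one_add_log (n + 1)
    rw [harmonic_eq_sum_Icc] at this
    push_cast at this ⊢
    simpa using this
  have hH0 : 0 ≤ ∑ j ∈ Finset.Icc 1 (n + 1), (1 / (j : ℝ)) :=
    Finset.sum_nonneg fun j _ => by positivity
  set H := ∑ j ∈ Finset.Icc 1 (n + 1), (1 / (j : ℝ)) with hH
  have hc : ((n + 1 : ℕ) : ℝ) = (n : ℝ) + 1 := by push_cast; ring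
  rw [hc] at hlog ⊢
  have hx : (0 : ℝ) < (n : ℝ) + 1 := by positivity
  set x : ℝ := (n : ℝ) + 1 with hxdef
  constructor
  · have : x ^ 2 * (h ^ 2 + 1 / x * (S ^ 2 - h ^ 2) * H)
        = x ^ 2 * h ^ 2 + x * ((S ^ 2 - h ^ 2) * H) := by
      field_simp
    rw [this]
    exact hk
  · rw [div_le_iff₀ (by positivity)]
    have : (h ^ 2 + (1 + Real.log x) / x * S ^ 2) * x ^ 2
        = x ^ 2 * h ^ 2 + x * (S ^ 2 * (1 + Real.log x)) := by
      field_simp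
    rw [this]
    have h3 : (S ^ 2 - h ^ 2) * H ≤ S ^ 2 * (1 + Real.log x) := by
      have h4 : S ^ 2 * H ≤ S ^ 2 * (1 + Real.log x) :=
        mul_le_mul_of_nonneg_left hlog (sq_nonneg S)
      nlinarith [mul_nonneg (sq_nonneg h) hH0]
    have := mul_le_mul_of_nonneg_left h3 hx.le
    linarith
end

section
/- Let (Ω, ℱ, ℙ) be a probability space, H a real Hilbert space, and (Y_i)_{i∈ℕ} : Ω → H a sequence of measurable random vectors. Suppose there exist γ > 0, b > 0 and A ≥ 0 such that E[e^{γ ‖Y_i‖²}] ≤ b for all i ∈ ℕ and E[‖Σ_{i=1}^n Y_i‖²] ≤ A·n for all n ∈ ℕ. Then ‖(1/n) Σ_{i=1}^n Y_i‖ → 0 almost surely as n → ∞. -/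
open MeasureTheory Finset

lemma ae_tendsto_zero_of_summable_integral
    {Ω : Type*} [MeasurableSpace Ω] (μ : Measure Ω)
    (f : ℕ → Ω → ℝ) (c : ℕ → ℝ) (hf0 : ∀ n ω, 0 ≤ f n ω)
    (hfi : ∀ n, Integrable (f n) μ) (hfc : ∀ n, ∫ ω, f n ω ∂μ ≤ c n) (hc : Summable c) :
    ∀ᵐ ω ∂μ, Filter.Tendsto (fun n => f n ω) Filter.atTop (nhds 0) := by
  have hmeas : ∀ n, AEMeasurable (fun ω => ENNReal.ofReal (f n ω)) μ :=
    fun n => (hfi n).aestronglyMeasurable.aemeasurable.ennreal_ofReal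
  have h1 : ∫⁻ ω, ∑' n, ENNReal.ofReal (f n ω) ∂μ ≠ ⊤ := by
    rw [lintegral_tsum hmeas]
    refine ne_top_of_le_ne_top hc.tsum_ofReal_ne_top (ENNReal.tsum_le_tsum fun n => ?_)
    rw [← ofReal_integral_eq_lintegral_ofReal (hfi n) (Filter.Eventually.of_forall (hf0 n))]
    exact ENNReal.ofReal_le_ofReal (hfc n)
  filter_upwards [ae_lt_top' (AEMeasurable.ennreal_tsum hmeas) h1] with ω hω
  have h2 := ENNReal.tendsto_atTop_zero_of_tsum_ne_top hω.ne
  have h3 := (ENNReal.tendsto_toReal ENNReal.zero_ne_top).comp h2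
  simpa [Function.comp_def, ENNReal.toReal_ofReal (hf0 _ ω)] using h3

lemma tendsto_average_of_squares {H : Type*} [NormedAddCommGroup H] [InnerProductSpace ℝ H]
    (y : ℕ → H)
    (ha : Filter.Tendsto (fun r : ℕ => ‖∑ i ∈ Finset.Icc 1 (r ^ 2), y i‖ ^ 2 / (r : ℝ) ^ 4)
      Filter.atTop (nhds 0))
    (hd : Filter.Tendsto (fun i : ℕ => ‖y (i + 1)‖ ^ 4 / ((i : ℝ) + 1) ^ 2)
      Filter.atTop (nhds 0)) :
    Filter.Tendsto (fun n : ℕ => ‖(1 / (n : ℝ)) • ∑ i ∈ Finset.Icc 1 n, y i‖)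
      Filter.atTop (nhds 0) := by
  rw [Metric.tendsto_atTop]
  intro δ hδ
  obtain ⟨ε, hε, hεδ⟩ : ∃ ε : ℝ, 0 < ε ∧ 3 * ε < δ := ⟨δ / 4, by positivity, by linarith⟩
  obtain ⟨R, hR⟩ := Filter.eventually_atTop.1 (ha.eventually_lt_const (pow_pos hε 2))
  obtain ⟨I, hI⟩ := Filter.eventually_atTop.1 (hd.eventually_lt_const (pow_pos hε 4))
  refine ⟨(R + I + 1) ^ 2, fun n hn => ?_⟩
  set r := Nat.sqrt n with hr
  have hrn : r ^ 2 ≤ n := Nat.sqrt_le' n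
  have hnr : n ≤ r ^ 2 + 2 * r := by
    have := Nat.sqrt_le_add n
    rw [← hr] at this
    nlinarith
  have hRr : R + I + 1 ≤ r := by
    rw [hr, Nat.le_sqrt']
    exact hn
  have hr1 : 1 ≤ r := by omega
  have hrpos : (0 : ℝ) < r := by exact_mod_cast hr1
  have hn1 : 1 ≤ n := by nlinarith
  have hnpos : (0 : ℝ) < n := by exact_mod_cast hn1
  have hrn' : (r : ℝ) ^ 2 ≤ n := by exact_mod_cast hrn
  have hrs : (r : ℝ) ≤ √n := Real.le_sqrt_of_sq_le hrn'
  have h1 : ‖∑ i ∈ Finset.Icc 1 (r ^ 2), y i‖ ≤ ε * r ^ 2 := by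
    have h := hR r (by omega)
    rw [div_lt_iff₀ (by positivity)] at h
    refine (pow_le_pow_iff_left₀ (norm_nonneg _) (by positivity) two_ne_zero).1 ?_
    nlinarith
  have h2 : ∀ i ∈ Finset.Ioc (r ^ 2) n, ‖y i‖ ≤ ε * √n := by
    intro i hi
    rw [Finset.mem_Ioc] at hi
    have hri : r ≤ r ^ 2 := by nlinarith
    have h := hI (i - 1) (by omega)
    have hi1 : i - 1 + 1 = i := by omega
    have hc : ((i - 1 : ℕ) : ℝ) + 1 = i := by exact_mod_cast hi1
    have hipos : (0 : ℝ) < i := by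
      have : 0 < i := by omega
      exact_mod_cast this
    rw [hi1, hc, div_lt_iff₀ (by positivity)] at h
    have h' : ‖y i‖ ≤ ε * √i := by
      refine (pow_le_pow_iff_left₀ (norm_nonneg _) (by positivity) four_ne_zero).1 ?_
      have e : (ε * √(i : ℝ)) ^ 4 = ε ^ 4 * (i : ℝ) ^ 2 := by
        have := Real.sq_sqrt hipos.le
        calc (ε * √(i : ℝ)) ^ 4 = ε ^ 4 * (√(i : ℝ) ^ 2) ^ 2 := by ring
          _ = _ := by rw [this]
      rw [e]
      exact h.le
    refine h'.trans (mul_le_mul_of_nonneg_left (Real.sqrt_le_sqrt ?_) hε.le)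
    exact_mod_cast hi.2
  have h3 : ‖∑ i ∈ Finset.Ioc (r ^ 2) n, y i‖ ≤ 2 * r * (ε * √n) := by
    refine (norm_sum_le_of_le _ h2).trans ?_
    rw [Finset.sum_const, Nat.card_Ioc, nsmul_eq_mul]
    refine mul_le_mul_of_nonneg_right ?_ (by positivity)
    have : n - r ^ 2 ≤ 2 * r := by omega
    exact_mod_cast this
  have hsplit : ∑ i ∈ Finset.Icc 1 n, y i
      = ∑ i ∈ Finset.Icc 1 (r ^ 2), y i + ∑ i ∈ Finset.Ioc (r ^ 2) n, y i := by
    have e : ∀ m, Finset.Icc 1 m = Finset.Ioc 0 m := by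
      intro m
      ext i
      simp [Nat.succ_le_iff]
    rw [e, e, Finset.sum_Ioc_consecutive _ (Nat.zero_le _) hrn]
  have h4 : ‖∑ i ∈ Finset.Icc 1 n, y i‖ ≤ 3 * ε * n := by
    rw [hsplit]
    refine (norm_add_le _ _).trans ((add_le_add h1 h3).trans ?_)
    have h5 : (r : ℝ) * √n ≤ n := by
      have := Real.mul_self_sqrt hnpos.le
      nlinarith [Real.sqrt_nonneg (n : ℝ)]
    nlinarith [mul_le_mul_of_nonneg_left h5 hε.le, mul_le_mul_of_nonneg_left hrn' hε.le]
  rw [Real.dist_eq, sub_zero, abs_of_nonneg (norm_nonneg _), norm_smul, Real.norm_eq_abs,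
    abs_of_nonneg (by positivity), one_div, inv_mul_eq_div, div_lt_iff₀ hnpos]
  nlinarith

/-- **Hilbert-space strong law; core of Lemma B.4 of the paper.**
For a sequence `(Y i)` of random vectors in a real Hilbert space with uniform exponential
moment bound `E[exp (γ ‖Y i‖²)] ≤ b` and mean-square bound `E[‖∑_{i=1}^n Y i‖²] ≤ A n` for
all `n`, we have `‖(1/n) ∑_{i=1}^n Y i‖ → 0` almost surely as `n → ∞`. -/
theorem hilbert_dependent_slln
    {Ω : Type*} [MeasurableSpace Ω] (μ : Measure Ω) [IsProbabilityMeasure μ]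
    {H : Type*} [NormedAddCommGroup H] [InnerProductSpace ℝ H]
    [MeasurableSpace H] [BorelSpace H]
    (Y : ℕ → Ω → H) (hY : ∀ i, Measurable (Y i))
    (γ b A : ℝ) (hγ : 0 < γ) (hb : 0 < b) (hA : 0 ≤ A)
    (hexp : ∀ i, 1 ≤ i →
      Integrable (fun ω => Real.exp (γ * ‖Y i ω‖ ^ 2)) μ ∧
        ∫ ω, Real.exp (γ * ‖Y i ω‖ ^ 2) ∂μ ≤ b)
    (hsum : ∀ n : ℕ,
      Integrable (fun ω => ‖∑ i ∈ Finset.Icc 1 n, Y i ω‖ ^ 2) μ ∧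
        ∫ ω, ‖∑ i ∈ Finset.Icc 1 n, Y i ω‖ ^ 2 ∂μ ≤ A * n) :
    ∀ᵐ ω ∂μ, Filter.Tendsto
      (fun n : ℕ => ‖(1 / (n : ℝ)) • ∑ i ∈ Finset.Icc 1 n, Y i ω‖)
      Filter.atTop (nhds 0) := by
  have ha := ae_tendsto_zero_of_summable_integral μ
    (fun r ω => ‖∑ i ∈ Finset.Icc 1 (r ^ 2), Y i ω‖ ^ 2 / (r : ℝ) ^ 4)
    (fun r => A * (1 / (r : ℝ) ^ 2)) (fun r ω => by positivity)
    (fun r => (hsum (r ^ 2)).1.div_const _)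
    (fun r => by
      rw [integral_div]
      rcases Nat.eq_zero_or_pos r with h | h
      · simp [h]
      have hr : (0 : ℝ) < r := by exact_mod_cast h
      rw [div_le_iff₀ (by positivity)]
      refine (hsum (r ^ 2)).2.trans (le_of_eq ?_)
      push_cast
      field_simp)
    ((Real.summable_one_div_nat_pow.2 one_lt_two).mul_left A)
  have hpt : ∀ i ω, ‖Y i ω‖ ^ 4 ≤ 2 / γ ^ 2 * Real.exp (γ * ‖Y i ω‖ ^ 2) := by
    intro i ω
    have h := Real.quadratic_le_exp_of_nonneg (x := γ * ‖Y i ω‖ ^ 2) (by positivity)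
    have h0 : 0 ≤ γ * ‖Y i ω‖ ^ 2 := by positivity
    rw [div_mul_eq_mul_div, le_div_iff₀ (by positivity)]
    nlinarith
  have hint : ∀ i, 1 ≤ i → Integrable (fun ω => ‖Y i ω‖ ^ 4) μ := by
    intro i hi
    refine ((hexp i hi).1.const_mul (2 / γ ^ 2)).mono'
      ((hY i).norm.pow_const 4).aestronglyMeasurable (Filter.Eventually.of_forall fun ω => ?_)
    rw [Real.norm_of_nonneg (by positivity)]
    exact hpt i ω
  have hd := ae_tendsto_zero_of_summable_integral μ
    (fun i ω => ‖Y (i + 1) ω‖ ^ 4 / ((i : ℝ) + 1) ^ 2)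
    (fun i => 2 / γ ^ 2 * b * (1 / ((i + 1 : ℕ) : ℝ) ^ 2)) (fun i ω => by positivity)
    (fun i => (hint (i + 1) (by omega)).div_const _)
    (fun i => by
      rw [integral_div, mul_one_div]
      push_cast
      refine div_le_div_of_nonneg_right ?_ (by positivity)
      refine (integral_mono (hint (i + 1) (by omega))
        ((hexp (i + 1) (by omega)).1.const_mul (2 / γ ^ 2)) (hpt (i + 1))).trans ?_
      rw [integral_const_mul]
      exact mul_le_mul_of_nonneg_left (hexp (i + 1) (by omega)).2 (by positivity))
    (((summable_nat_add_iff 1).2 (Real.summable_one_div_nat_pow.2 one_lt_two)).mul_left _)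
  filter_upwards [ha, hd] with ω h1 h2
  exact tendsto_average_of_squares (fun i => Y i ω) h1 h2
end

section
/- Let (Ω, ℱ, ℙ) be a probability space, X a measurable space, f : X → [0,∞) a nonnegative measurable function, and (X_i)_{i∈ℕ} : Ω → X a sequence of random variables. Suppose there exists γ > 0 such that b := sup_{i∈ℕ} E[e^{γ f(X_i)}] < ∞. Let n : ℕ → ℕ be a function of m with m ≤ n(m) and log(n(m)) = O(m^{β/2}) for some β < 1. Then (log(m)/m) · max_{1≤i≤n(m)} f(X_i) → 0 almost surely as m → ∞. -/
open MeasureTheory Finset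

/-- **Lemma B.5 of the paper.**
Let `f : 𝒳 → [0,∞)` be measurable and `(X i)` a sequence of random variables with a uniform
exponential moment bound `sup_i E[exp (γ f (X i))] ≤ b < ∞`.  If `m ≤ n m` and
`log (n m) = O(m^(β/2))` for some `β < 1`, then
`(log m / m) * max_{1 ≤ i ≤ n m} f (X i) → 0` almost surely as `m → ∞`. -/
theorem running_max_killed_by_log_over_m
    {Ω 𝒳 : Type*} [MeasurableSpace Ω] [MeasurableSpace 𝒳]
    (μ : Measure Ω) [IsProbabilityMeasure μ]
    (f : 𝒳 → ℝ) (hf : Measurable f) (hf0 : ∀ x, 0 ≤ f x)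
    (X : ℕ → Ω → 𝒳) (hX : ∀ i, Measurable (X i))
    (γ b : ℝ) (hγ : 0 < γ)
    (hb : ∀ i, 1 ≤ i →
      Integrable (fun ω => Real.exp (γ * f (X i ω))) μ ∧
        ∫ ω, Real.exp (γ * f (X i ω)) ∂μ ≤ b)
    (n : ℕ → ℕ) (hn1 : ∀ m, 1 ≤ n m) (hmn : ∀ m, m ≤ n m)
    (β : ℝ) (hβ : β < 1)
    (hgrowth : (fun m : ℕ => Real.log (n m)) =O[Filter.atTop]
      (fun m : ℕ => (m : ℝ) ^ (β / 2))) :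
    ∀ᵐ ω ∂μ, Filter.Tendsto
      (fun m : ℕ => (Real.log m / m) *
        (Finset.Icc 1 (n m)).sup' (Finset.nonempty_Icc.mpr (hn1 m)) (fun i => f (X i ω)))
      Filter.atTop (nhds 0) := by
  have hb0 : 0 ≤ b := le_trans (integral_nonneg fun ω => (Real.exp_pos _).le) (hb 1 le_rfl).2
  -- Borel-Cantelli for the events `(i+1)^2 ≤ exp (γ f (X (i+1)))`
  have hBC : ∀ᵐ ω ∂μ, ∀ᶠ i : ℕ in Filter.atTop,
      ω ∉ {ω | ((i : ℝ) + 1) ^ 2 ≤ Real.exp (γ * f (X (i + 1) ω))} := by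
    apply ae_eventually_notMem
    have hle : ∀ i : ℕ, μ {ω | ((i : ℝ) + 1) ^ 2 ≤ Real.exp (γ * f (X (i + 1) ω))} ≤
        ENNReal.ofReal (b * (1 / ((i : ℝ) + 1) ^ 2)) := by
      intro i
      have h := mul_meas_ge_le_integral_of_nonneg (μ := μ)
        (Filter.Eventually.of_forall fun ω => (Real.exp_pos (γ * f (X (i + 1) ω))).le)
        (hb (i + 1) (by omega)).1 (((i : ℝ) + 1) ^ 2)
      have h2 := h.trans (hb (i + 1) (by omega)).2
      rw [← ofReal_measureReal]
      apply ENNReal.ofReal_le_ofReal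
      rw [mul_one_div, le_div_iff₀ (by positivity), mul_comm]
      exact h2
    have hs : Summable (fun i : ℕ => b * (1 / ((i : ℝ) + 1) ^ 2)) := by
      apply Summable.mul_left
      have := (summable_nat_add_iff 1).mpr
        (Real.summable_one_div_nat_pow.mpr (one_lt_two))
      simpa using this
    exact ne_top_of_le_ne_top hs.tsum_ofReal_ne_top (ENNReal.tsum_le_tsum hle)
  -- deterministic limits
  have hlim1 : Filter.Tendsto (fun m : ℕ => Real.log m / m) Filter.atTop (nhds 0) := by
    have h := (isLittleO_log_rpow_atTop (r := 1) one_pos).tendsto_div_nhds_zero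
    simpa [Function.comp_def] using h.comp tendsto_natCast_atTop_atTop
  have hlim2 : Filter.Tendsto (fun m : ℕ => Real.log m / m * Real.log (n m))
      Filter.atTop (nhds 0) := by
    have hO : (fun m : ℕ => Real.log m / m * Real.log (n m)) =O[Filter.atTop]
        (fun m : ℕ => Real.log m / m * (m : ℝ) ^ (β / 2)) :=
      (Asymptotics.isBigO_refl _ _).mul hgrowth
    refine hO.trans_tendsto ?_
    have h := (isLittleO_log_rpow_atTop (r := 1 - β / 2) (by linarith)).tendsto_div_nhds_zero
    have h' := h.comp tendsto_natCast_atTop_atTop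
    refine h'.congr' ?_
    filter_upwards [Filter.eventually_gt_atTop 0] with m hm
    have hm' : (0 : ℝ) < m := by exact_mod_cast hm
    have hp : (0 : ℝ) < (m : ℝ) ^ (β / 2) := Real.rpow_pos_of_pos hm' _
    simp only [Function.comp_def]
    rw [Real.rpow_sub hm', Real.rpow_one]
    field_simp
  filter_upwards [hBC] with ω hω
  obtain ⟨N, hN⟩ := Filter.eventually_atTop.mp hω
  set C : ℝ := ∑ i ∈ Finset.range N, f (X (i + 1) ω) with hC
  have hC0 : 0 ≤ C := Finset.sum_nonneg fun i _ => hf0 _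
  have hbound : ∀ i : ℕ, f (X (i + 1) ω) ≤ C + 2 / γ * Real.log ((i : ℝ) + 1) := by
    intro i
    have hlog : 0 ≤ Real.log ((i : ℝ) + 1) :=
      Real.log_nonneg (by have : (0 : ℝ) ≤ i := Nat.cast_nonneg i
                          linarith)
    by_cases hi : i < N
    · have : f (X (i + 1) ω) ≤ C :=
        Finset.single_le_sum (f := fun i => f (X (i + 1) ω)) (fun j _ => hf0 _)
          (Finset.mem_range.mpr hi)
      have : 0 ≤ 2 / γ * Real.log ((i : ℝ) + 1) := by positivity
      linarith
    · have h := hN i (not_lt.mp hi)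
      simp only [Set.mem_setOf_eq, not_le] at h
      have h2 := (Real.lt_log_iff_exp_lt (by positivity)).mpr h
      rw [Real.log_pow] at h2
      have h3 : f (X (i + 1) ω) ≤ 2 / γ * Real.log ((i : ℝ) + 1) := by
        rw [div_mul_eq_mul_div, le_div_iff₀ hγ]
        push_cast at h2
        linarith
      linarith
  have hup : Filter.Tendsto (fun m : ℕ => Real.log m / m * C +
      2 / γ * (Real.log m / m * Real.log (n m))) Filter.atTop (nhds 0) := by
    simpa using (hlim1.mul_const C).add (hlim2.const_mul (2 / γ))
  refine squeeze_zero (fun m => ?_) (fun m => ?_) hup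
  · refine mul_nonneg (div_nonneg (Real.log_natCast_nonneg m) (Nat.cast_nonneg m)) ?_
    exact (hf0 (X 1 ω)).trans
      (Finset.le_sup' (fun i => f (X i ω)) (Finset.mem_Icc.mpr ⟨le_rfl, hn1 m⟩))
  · have hsup : (Finset.Icc 1 (n m)).sup' (Finset.nonempty_Icc.mpr (hn1 m))
        (fun i => f (X i ω)) ≤ C + 2 / γ * Real.log (n m) := by
      apply Finset.sup'_le
      intro i hi
      obtain ⟨h1, h2⟩ := Finset.mem_Icc.mp hi
      obtain ⟨j, rfl⟩ := Nat.exists_eq_add_of_le' h1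
      refine (hbound j).trans ?_
      have : Real.log ((j : ℝ) + 1) ≤ Real.log (n m) :=
        Real.log_le_log (by positivity) (by exact_mod_cast h2)
      gcongr
    have h0 : 0 ≤ Real.log m / (m : ℝ) :=
      div_nonneg (Real.log_natCast_nonneg m) (Nat.cast_nonneg m)
    calc _ ≤ Real.log m / (m : ℝ) * (C + 2 / γ * Real.log (n m)) :=
          mul_le_mul_of_nonneg_left hsup h0
      _ = _ := by ring
end
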